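/- arXiv:1411.4410 — 2 statements merged into one kernel-verified Lean document; each statement's English description precedes it below -/
import Mathlib

section
/- Let R be a nontrivial (0 ≠ 1) reduced commutative ring. The three fracpairs (0, 1), (1, 1), and (1, 0) over R are pairwise non-cc-equivalent. -/
/-- One step of the common cancellation relation CC:
`(x*z, y*(z*z))` is related to `(x, y*z)`. -/
def CC {R : Type*} [CommRing R] (a b : R × R) : Prop :=
  ∃ x y z : R, a = (x * z, y * (z * z)) ∧ b = (x, y * z)

/-- cc-equivalence: the smallest equivalence relation containing all instances of CC. -/
def ccEq {R : Type*} [CommRing R] (a b : R × R) : Prop :=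
  Relation.EqvGen CC a b

theorem Relation.EqvGen.iff_of_forall_iff {α : Type*} {r : α → α → Prop} {p : α → Prop}
    (h : ∀ a b, r a b → (p a ↔ p b)) {a b : α} (hab : Relation.EqvGen r a b) : p a ↔ p b := by
  induction hab with
  | rel a b hab => exact h a b hab
  | refl a => exact Iff.rfl
  | symm a b _ ih => exact ih.symm
  | trans a b c _ _ ihab ihbc => exact ihab.trans ihbc

/-- Over a reduced ring, cc-equivalence preserves vanishing of the denominator. -/
theorem ccEq.snd_eq_zero_iff {R : Type*} [CommRing R] (hred : ∀ x : R, x * x = 0 → x = 0)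
    {a b : R × R} (hab : ccEq a b) : a.2 = 0 ↔ b.2 = 0 := by
  refine Relation.EqvGen.iff_of_forall_iff (p := fun a : R × R => a.2 = 0) ?_ hab
  rintro _ _ ⟨x, y, z, rfl, rfl⟩
  refine ⟨fun h => hred _ ?_, fun h => ?_⟩
  · linear_combination y * h
  · linear_combination z * h

/-- Over a reduced ring, cc-equivalence preserves vanishing of the product of numerator and
denominator. -/
theorem ccEq.fst_mul_snd_eq_zero_iff {R : Type*} [CommRing R]
    (hred : ∀ x : R, x * x = 0 → x = 0) {a b : R × R} (hab : ccEq a b) :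
    a.1 * a.2 = 0 ↔ b.1 * b.2 = 0 := by
  refine Relation.EqvGen.iff_of_forall_iff (p := fun a : R × R => a.1 * a.2 = 0) ?_ hab
  rintro _ _ ⟨x, y, z, rfl, rfl⟩
  refine ⟨fun h => ?_, fun h => ?_⟩
  · have hz : x * y * z * z = 0 := hred _ (by linear_combination x * y * z * h)
    exact hred _ (by linear_combination x * y * hz)
  · linear_combination z * z * h

theorem stmt4 {R : Type*} [CommRing R] (hred : ∀ x : R, x * x = 0 → x = 0)
    (hnt : (0 : R) ≠ 1) :
    ¬ ccEq ((0, 1) : R × R) (1, 1) ∧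
    ¬ ccEq ((0, 1) : R × R) (1, 0) ∧
    ¬ ccEq ((1, 1) : R × R) (1, 0) := by
  refine ⟨fun h => ?_, fun h => ?_, fun h => ?_⟩
  · have := ccEq.fst_mul_snd_eq_zero_iff hred h
    simp [hnt.symm] at this
  · have := ccEq.snd_eq_zero_iff hred h
    simp [hnt.symm] at this
  · have := ccEq.snd_eq_zero_iff hred h
    simp [hnt.symm] at this
end

section
/- In any common meadow, x·y⁻¹ + u·v⁻¹ = (x·v + u·y)·(y·v)⁻¹ for all x, y, u, v. -/
/-- A common meadow: a commutative monoid for `+` and `·` with a weak additive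
inverse, an inverse operation, and an absorbing error element `⊥`, satisfying
the axioms of Bergstra–Ponse. -/
class CommonMeadow (M : Type*) extends Zero M, One M, Add M, Mul M, Neg M, Inv M where
  bot : M
  add_assoc : ∀ x y z : M, (x + y) + z = x + (y + z)
  add_comm : ∀ x y : M, x + y = y + x
  add_zero : ∀ x : M, x + 0 = x
  add_neg : ∀ x : M, x + (-x) = 0 * x
  neg_neg : ∀ x : M, -(-x) = x
  mul_assoc : ∀ x y z : M, (x * y) * z = x * (y * z)
  mul_comm : ∀ x y : M, x * y = y * x
  one_mul : ∀ x : M, 1 * x = x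
  mul_add : ∀ x y z : M, x * (y + z) = x * y + x * z
  zero_mul_sq : ∀ x : M, 0 * (x * x) = 0 * x
  inv_inv : ∀ x : M, (x⁻¹)⁻¹ = x + 0 * x⁻¹
  mul_inv : ∀ x : M, x * x⁻¹ = 1 + 0 * x⁻¹
  mul_inv_distrib : ∀ x y : M, (x * y)⁻¹ = x⁻¹ * y⁻¹
  one_inv : (1 : M)⁻¹ = 1
  zero_inv : (0 : M)⁻¹ = bot
  add_bot : ∀ x : M, x + bot = bot
  mul_bot : ∀ x : M, x * bot = bot

namespace CommonMeadow

variable {M : Type*} [CommonMeadow M]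

instance : Std.Associative (α := M) (· + ·) := ⟨add_assoc⟩

instance : Std.Commutative (α := M) (· + ·) := ⟨add_comm⟩

instance : Std.Associative (α := M) (· * ·) := ⟨mul_assoc⟩

instance : Std.Commutative (α := M) (· * ·) := ⟨mul_comm⟩

theorem mul_one (x : M) : x * 1 = x := by
  rw [mul_comm, one_mul]

theorem add_mul (x y z : M) : (x + y) * z = x * z + y * z := by
  rw [mul_comm, mul_add, mul_comm z x, mul_comm z y]

/-- The zero multiple of a factor is absorbed by the product. -/
theorem mul_add_zero_mul (x y : M) : x * y + 0 * y = x * y := by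
  rw [← add_mul, add_zero]

theorem add_zero_mul_self (x : M) : x + 0 * x = x := by
  simpa only [one_mul] using mul_add_zero_mul 1 x

theorem zero_mul_add_self (x : M) : 0 * x + 0 * x = 0 * x := by
  rw [← add_mul, add_zero]

theorem zero_mul_mul (x y : M) : 0 * (x * y) = 0 * x + 0 * y := by
  have absorb_right (a b : M) : 0 * (a * b) + 0 * b = 0 * (a * b) := by
    rw [← mul_assoc, mul_add_zero_mul]
  have absorb_left : 0 * (x * y) + 0 * x = 0 * (x * y) := by
    rw [mul_comm x y, absorb_right]
  have square : 0 * x + 0 * y = (0 * x + 0 * (x * y)) + (0 * (x * y) + 0 * y) := by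
    rw [← mul_add, ← zero_mul_sq (x + y), mul_add (x + y), add_mul, add_mul, mul_comm y x,
      mul_add, mul_add, mul_add, zero_mul_sq, zero_mul_sq]
  rw [square, add_comm (0 * x), absorb_left, absorb_right, zero_mul_add_self]

theorem add_mul_zero_mul (x y : M) : x + x * (0 * y) = x + 0 * y := by
  have h : x * (0 * y) = 0 * x + 0 * y := by
    rw [← zero_mul_mul]
    ac_rfl
  rw [h, ← add_assoc, add_zero_mul_self]

theorem mul_mul_inv (x y : M) : x * (y * y⁻¹) = x + 0 * y⁻¹ := by
  rw [mul_inv, mul_add, mul_one, add_mul_zero_mul]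

end CommonMeadow

theorem stmt15 {M : Type*} [CommonMeadow M] (x y u v : M) :
    x * y⁻¹ + u * v⁻¹ = (x * v + u * y) * (y * v)⁻¹ := by
  symm
  calc
    (x * v + u * y) * (y * v)⁻¹
        = (x * y⁻¹) * (v * v⁻¹) + (u * v⁻¹) * (y * y⁻¹) := by
      rw [CommonMeadow.mul_inv_distrib, CommonMeadow.add_mul]
      ac_rfl
    _ = (x * y⁻¹ + 0 * v⁻¹) + (u * v⁻¹ + 0 * y⁻¹) := by
      rw [CommonMeadow.mul_mul_inv, CommonMeadow.mul_mul_inv]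
    _ = (x * y⁻¹ + 0 * y⁻¹) + (u * v⁻¹ + 0 * v⁻¹) := by
      ac_rfl
    _ = x * y⁻¹ + u * v⁻¹ := by
      rw [CommonMeadow.mul_add_zero_mul, CommonMeadow.mul_add_zero_mul]
end
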